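/- Let λ̄ > 0 and β̄ ≥ 1, set p(l,m) := 1/(1−e^{−l}) + 1/(1−e^{l−m}), and define W̄(F) := sup_{μ > λ̄} (1/μ)( λ̄ F − log p(λ̄,μ) − log β̄ ). Then for every F > 0, F − W̄(F) ≤ F · ( 1 + log p(λ̄, λ̄ + 1/F) + log β̄ ) / (λ̄ F + 1). In particular F − W̄(F) ≤ (1 + log p(λ̄, λ̄ + 1/F) + log β̄)/λ̄, so F − W̄(F) grows at most like (log F)/λ̄ as F → ∞. -/

import Mathlib

/-- The function `p(l,m) = 1/(1-e^{-l}) + 1/(1-e^{l-m})`. -/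
noncomputable def pfun (l m : ℝ) : ℝ :=
  1 / (1 - Real.exp (-l)) + 1 / (1 - Real.exp (l - m))

/-- The lower-bound velocity `W̄(F) = sup_{μ > λ̄} (1/μ)(λ̄ F - log p(λ̄,μ) - log β̄)`. -/
noncomputable def Wbar (lam bet F : ℝ) : ℝ :=
  sSup {x : ℝ | ∃ μ > lam, x = (1 / μ) * (lam * F - Real.log (pfun lam μ) - Real.log bet)}

theorem one_le_one_div_one_sub_exp {x : ℝ} (hx : x < 0) : 1 ≤ 1 / (1 - Real.exp x) := by
  have h1 : Real.exp x < 1 := by simpa using hx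
  rw [le_div_iff₀ (by linarith)]
  linarith [Real.exp_pos x]

theorem log_pfun_nonneg {l m : ℝ} (hl : 0 < l) (hm : l < m) : 0 ≤ Real.log (pfun l m) := by
  apply Real.log_nonneg
  have h1 := one_le_one_div_one_sub_exp (neg_lt_zero.mpr hl)
  have h2 := one_le_one_div_one_sub_exp (sub_neg.mpr hm)
  unfold pfun
  linarith

theorem le_Wbar {lam bet F μ : ℝ} (hlam : 0 < lam) (hbet : 1 ≤ bet) (hF : 0 < F) (hμ : lam < μ) :
    (1 / μ) * (lam * F - Real.log (pfun lam μ) - Real.log bet) ≤ Wbar lam bet F := by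
  refine le_csSup ⟨F, ?_⟩ ⟨μ, hμ, rfl⟩
  rintro x ⟨ν, hν, rfl⟩
  have hν0 : 0 < ν := hlam.trans hν
  rw [one_div_mul_eq_div, div_le_iff₀ hν0]
  nlinarith [log_pfun_nonneg hlam hν, Real.log_nonneg hbet, mul_lt_mul_of_pos_right hν hF]

/-- evaluating the supremum defining `W̄(F)` at `μ = λ̄ + 1/F` gives
`F - W̄(F) ≤ F (1 + log p(λ̄, λ̄ + 1/F) + log β̄)/(λ̄ F + 1)`, and in particular
`F - W̄(F) ≤ (1 + log p(λ̄, λ̄ + 1/F) + log β̄)/λ̄`. -/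
theorem stmt11 (lam bet : ℝ) (hlam : 0 < lam) (hbet : 1 ≤ bet) :
    ∀ F : ℝ, 0 < F →
      F - Wbar lam bet F ≤
        F * (1 + Real.log (pfun lam (lam + 1 / F)) + Real.log bet) / (lam * F + 1) ∧
      F - Wbar lam bet F ≤
        (1 + Real.log (pfun lam (lam + 1 / F)) + Real.log bet) / lam := by
  intro F hF
  have hμ : lam < lam + 1 / F := lt_add_of_pos_right lam (by positivity)
  have hW := le_Wbar hlam hbet hF hμ
  have hL := log_pfun_nonneg hlam hμ
  have hB := Real.log_nonneg hbet
  generalize Real.log (pfun lam (lam + 1 / F)) = L at hW hL ⊢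
  generalize Real.log bet = B at hW hB ⊢
  have hpos : 0 < lam * F + 1 := by positivity
  have heq : F - (1 / (lam + 1 / F)) * (lam * F - L - B) =
      F * (1 + L + B) / (lam * F + 1) := by
    field_simp
    ring
  have hle : F - Wbar lam bet F ≤ F * (1 + L + B) / (lam * F + 1) := by linarith
  refine ⟨hle, hle.trans ?_⟩
  rw [div_le_div_iff₀ hpos hlam]
  nlinarith
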